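/- arXiv:1809.06251 — 7 statements merged into one kernel-verified Lean document; each statement's English description precedes it below -/
import Mathlib

section
/- If G is a finite group whose order is squarefree, and there exist a division ring D and an injective group homomorphism from G into the unit group Dˣ, then G is cyclic. -/
open scoped commutatorElement

lemma aux_geom {D : Type} [DivisionRing D] (u : D) (n : ℕ) (h1 : u ≠ 1) (hn : u ^ n = 1) :
    ∑ i ∈ Finset.range n, u ^ i = 0 := by
  have h := geom_sum_mul u n
  rw [hn, sub_self] at h
  exact (mul_eq_zero.mp h).resolve_right (sub_ne_zero.mpr h1)

lemma aux_conj {H : Type} [Group H] (a y : H) (hc : Commute a (y * a * y⁻¹)) (i : ℕ) :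
    a ^ i * y * (a ^ i)⁻¹ = (a * (y * a * y⁻¹)⁻¹) ^ i * y := by
  rw [hc.inv_right.mul_pow, inv_pow, conj_pow]
  group

lemma aux_commute {D : Type} [DivisionRing D] (a x : Dˣ) (p q : ℕ) (hp : p.Prime) (hq : q.Prime)
    (ha : a ^ p = 1) (ha1 : a ≠ 1) (hx : x ^ q = 1)
    (hc : ∀ j : ℕ, Commute a (x ^ j * a * (x ^ j)⁻¹)) : Commute x a := by
  by_contra hxa
  have hx1 : x ≠ 1 := by
    rintro rfl
    exact hxa (Commute.one_left a)
  have hxo : orderOf x = q := by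
    have := Fact.mk hq
    exact orderOf_eq_prime hx hx1
  have hS : ∑ i ∈ Finset.range p, ∑ j ∈ Finset.range q,
      ((a ^ i * x ^ j * (a ^ i)⁻¹ : Dˣ) : D) = 0 := by
    refine Finset.sum_eq_zero fun i _ => ?_
    simp only [Units.val_mul]
    rw [← Finset.sum_mul, ← Finset.mul_sum]
    simp only [Units.val_pow_eq_pow_val]
    rw [aux_geom (x : D) q (by simpa using hx1) (by rw [← Units.val_pow_eq_pow_val, hx, Units.val_one])]
    simp
  rw [Finset.sum_comm, Finset.sum_eq_single 0] at hS
  · have hp0 : (p : D) = 0 := by simpa using hS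
    have := Fact.mk hp
    have : CharP D p := by
      obtain ⟨r, hr⟩ := CharP.exists D
      have hd := (CharP.cast_eq_zero_iff D r p).mp hp0
      rcases (Nat.dvd_prime hp).mp hd with h | h
      · subst h
        exact absurd rfl (CharP.char_ne_one D 1)
      · exact h ▸ hr
    have h0 : ((a : D) - 1) ^ p = 0 := by
      rw [sub_pow_char_of_commute (p := p) (Commute.one_right (a : D)), one_pow, sub_eq_zero]
      rw [← Units.val_pow_eq_pow_val, ha, Units.val_one]
    exact ha1 (Units.ext (sub_eq_zero.mp (pow_eq_zero_iff hp.ne_zero |>.mp h0)))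
  · intro j hj hj0
    simp only [aux_conj a (x ^ j) (hc j), Units.val_mul _ (x ^ j)]
    rw [← Finset.sum_mul]
    simp only [Units.val_pow_eq_pow_val _ _]
    rw [aux_geom _ p ?_ ?_, zero_mul]
    · intro h
      have h' : a * (x ^ j * a * (x ^ j)⁻¹)⁻¹ = 1 := Units.ext h
      rw [mul_inv_eq_one] at h'
      have hcj : Commute (x ^ j) a := by
        have := eq_mul_inv_iff_mul_eq.mp h'
        exact this.symm
      have hcop : j.Coprime (orderOf x) := by
        rw [hxo]
        exact (Nat.coprime_of_lt_prime hj0 (Finset.mem_range.mp hj) hq).symm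
      obtain ⟨m, hm⟩ := exists_pow_eq_self_of_coprime hcop
      exact hxa (hm ▸ hcj.pow_left m)
    · have : (a * (x ^ j * a * (x ^ j)⁻¹)⁻¹) ^ p = 1 := by
        rw [(hc j).inv_right.mul_pow, inv_pow, conj_pow, ha]
        simp
      rw [← Units.val_pow_eq_pow_val, this, Units.val_one]
  · intro h
    exact absurd (Finset.mem_range.mpr hq.pos) h

lemma aux_le {G : Type} [Group G] [Finite G] (hG : Squarefree (Nat.card G)) (H K : Subgroup G)
    (h : ∀ q : ℕ, q.Prime → ∀ x ∈ H, orderOf x = q → x ∈ K) : H ≤ K := by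
  rw [← Subgroup.relIndex_eq_one]
  by_contra hne
  obtain ⟨q, hq, hqd⟩ := Nat.exists_prime_and_dvd hne
  have := Fact.mk hq
  have hmul : Nat.card (K.subgroupOf H) * K.relIndex H = Nat.card H :=
    Subgroup.card_mul_index _
  obtain ⟨x, hx⟩ := exists_prime_orderOf_dvd_card' (G := H) q (hmul ▸ hqd.mul_left _)
  have hxK : x ∈ K.subgroupOf H :=
    h q hq x x.2 (by rw [Subgroup.orderOf_coe]; exact hx)
  have hd : q ∣ Nat.card (K.subgroupOf H) := by
    rw [← hx]
    exact Subgroup.orderOf_dvd_natCard _ hxK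
  have h2 : q * q ∣ Nat.card G :=
    (hmul ▸ mul_dvd_mul hd hqd).trans (Subgroup.card_subgroup_dvd_card H)
  exact hq.one_lt.ne' (Nat.isUnit_iff.mp (hG q h2))

theorem cyclic_of_squarefree_embeddable_in_division_ring
    (G : Type) [Group G] [Finite G] (hG : Squarefree (Nat.card G))
    (D : Type) [DivisionRing D] (f : G →* Dˣ) (hf : Function.Injective f) :
    IsCyclic G := by
  have hZ : IsZGroup G := IsZGroup.of_squarefree hG
  have hcyc : IsCyclic (commutator G) := IsZGroup.isCyclic_commutator G
  have hcomm : ∀ a ∈ commutator G, ∀ b ∈ commutator G, Commute a b := by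
    intro a ha b hb
    obtain ⟨g, hg⟩ := hcyc.exists_generator
    obtain ⟨m, hm⟩ := hg ⟨a, ha⟩
    obtain ⟨n, hn⟩ := hg ⟨b, hb⟩
    have hm' : (g : G) ^ m = a := congrArg Subtype.val hm
    have hn' : (g : G) ^ n = b := congrArg Subtype.val hn
    rw [← hm', ← hn']
    exact (Commute.refl (g : G)).zpow_zpow m n
  have hle : commutator G ≤ Subgroup.center G := by
    refine aux_le hG _ _ fun p hp a haN hap => ?_
    have htop : (⊤ : Subgroup G) ≤ Subgroup.centralizer {a} := by
      refine aux_le hG _ _ fun q hq x _ hxq => ?_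
      have hc : Commute (f x) (f a) := by
        refine aux_commute (f a) (f x) p q hp hq ?_ ?_ ?_ ?_
        · rw [← map_pow, ← hap, pow_orderOf_eq_one, map_one]
        · intro h
          rw [(map_eq_one_iff f hf).mp h, orderOf_one] at hap
          exact hp.one_lt.ne hap
        · rw [← map_pow, ← hxq, pow_orderOf_eq_one, map_one]
        · intro j
          have := (hcomm a haN (x ^ j * a * (x ^ j)⁻¹)
            ((inferInstance : (commutator G).Normal).conj_mem a haN (x ^ j))).map f
          simpa using this
      rw [Subgroup.mem_centralizer_singleton_iff]
      apply hf
      simpa using hc.eq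
    rw [Subgroup.mem_center_iff]
    intro g
    exact Subgroup.mem_centralizer_singleton_iff.mp (htop (Subgroup.mem_top g))
  have hnil : Group.IsNilpotent G := by
    apply Group.of_quotient_center_nilpotent
    have hab : ∀ a b : G ⧸ Subgroup.center G, a * b = b * a := by
      intro a b
      induction a using QuotientGroup.induction_on with | H a => ?_
      induction b using QuotientGroup.induction_on with | H b => ?_
      rw [← QuotientGroup.mk_mul, ← QuotientGroup.mk_mul, QuotientGroup.eq]
      apply hle
      have : (a * b)⁻¹ * (b * a) = ⁅b⁻¹, a⁻¹⁆ := by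
        rw [commutatorElement_def]; group
      rw [this]
      exact Subgroup.commutator_mem_commutator (Subgroup.mem_top _) (Subgroup.mem_top _)
    let _ : CommGroup (G ⧸ Subgroup.center G) := { mul_comm := hab }
    exact CommGroup.isNilpotent
  infer_instance
end

section
/- Let m, n, r be positive integers with gcd(r, m) = 1 and n > 1, and suppose that the multiplicative order of r modulo m is exactly n. Let G be the semidirect product ℤ/mℤ ⋊ ℤ/nℤ in which a generator of ℤ/nℤ acts on ℤ/mℤ by multiplication by r. Then for every division ring D there is no injective group homomorphism from G into the unit group Dˣ. -/
open Polynomial in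
theorem division_ring_aux {D : Type} [DivisionRing D] (n r : ℕ) (hn : 1 < n) (a b : D)
    (hconj : b * a = a ^ r * b) (hbn : b ^ n = 1) (hb : b ≠ 1)
    (hne : ∀ s, 1 ≤ s → s < n → a ≠ a ^ (r ^ s)) : False := by
  have hpow : ∀ k, b * a ^ k = (a ^ r) ^ k * b := by
    intro k
    induction k with
    | zero => simp
    | succ k ih => rw [pow_succ, ← mul_assoc, ih, mul_assoc, hconj, ← mul_assoc, ← pow_succ]
  have hconj2 : ∀ i, b ^ i * a = a ^ (r ^ i) * b ^ i := by
    intro i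
    induction i with
    | zero => simp
    | succ i ih =>
      rw [pow_succ' b, mul_assoc, ih, ← mul_assoc, hpow, ← pow_mul, ← pow_succ', mul_assoc]
  have hsum : ∑ i ∈ Finset.range n, b ^ i = 0 := by
    have h := mul_geom_sum b n
    rw [hbn, sub_self] at h
    exact (mul_eq_zero.mp h).resolve_left (sub_ne_zero.mpr hb)
  let P : ℕ → ℕ → ℤ[X] := fun k i => ∏ s ∈ Finset.Icc 1 k, (X ^ (r ^ i) - X ^ (r ^ s))
  have key : ∀ k, ∑ i ∈ Finset.range n, aeval a (P k i) * b ^ i = 0 := by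
    intro k
    induction k with
    | zero => simpa [P] using hsum
    | succ k ih =>
      have h1 : ∀ i, aeval a (P (k+1) i) * b ^ i =
          aeval a (P k i) * b ^ i * a - a ^ (r ^ (k+1)) * (aeval a (P k i) * b ^ i) := by
        intro i
        have e : P (k+1) i = P k i * X ^ (r ^ i) - X ^ (r ^ (k+1)) * P k i := by
          simp only [P]
          rw [Finset.prod_Icc_succ_top (by omega)]
          ring
        rw [e, mul_assoc, hconj2]
        simp only [map_sub, map_mul, map_pow, aeval_X, sub_mul, mul_assoc]
      simp_rw [h1]
      rw [Finset.sum_sub_distrib, ← Finset.sum_mul, ← Finset.mul_sum, ih]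
      simp
  have h0 := key (n - 1)
  rw [Finset.sum_eq_single 0] at h0
  · have : aeval a (P (n-1) 0) ≠ 0 := by
      simp only [P]
      refine Finset.prod_induction _ (fun p : ℤ[X] => aeval a p ≠ 0) ?_ ?_ ?_
      · intro p q hp hq
        rw [map_mul]
        exact mul_ne_zero hp hq
      · simp
      · intro s hs
        rw [Finset.mem_Icc] at hs
        simpa [sub_eq_zero] using hne s hs.1 (by omega)
    simp at h0
    exact this h0
  · intro i hi hi0
    rw [Finset.mem_range] at hi
    have : P (n-1) i = 0 :=
      Finset.prod_eq_zero (i := i) (Finset.mem_Icc.mpr ⟨by omega, by omega⟩) (sub_self _)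
    simp [this]
  · intro h
    exact absurd (Finset.mem_range.mpr (by omega)) h

theorem no_embedding_of_metacyclic_with_faithful_action
    (m n r : ℕ) (hm : 0 < m) (hn : 1 < n) (hr : 0 < r)
    (hcop : Nat.Coprime r m)
    (hord : orderOf (ZMod.unitOfCoprime r hcop) = n)
    (φ : Multiplicative (ZMod n) →* MulAut (Multiplicative (ZMod m)))
    (hφ : ∀ x : Multiplicative (ZMod m),
      φ (Multiplicative.ofAdd (1 : ZMod n)) x =
        Multiplicative.ofAdd ((r : ZMod m) * Multiplicative.toAdd x))
    (D : Type) [DivisionRing D]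
    (f : SemidirectProduct (Multiplicative (ZMod m)) (Multiplicative (ZMod n)) φ →* Dˣ) :
    ¬ Function.Injective f := by
  intro hf
  have : Fact (1 < n) := ⟨hn⟩
  let a0 : Multiplicative (ZMod m) := Multiplicative.ofAdd 1
  let b0 : Multiplicative (ZMod n) := Multiplicative.ofAdd 1
  let A : SemidirectProduct (Multiplicative (ZMod m)) (Multiplicative (ZMod n)) φ :=
    SemidirectProduct.inl a0
  let B : SemidirectProduct (Multiplicative (ZMod m)) (Multiplicative (ZMod n)) φ :=
    SemidirectProduct.inr b0
  have ha0 : ∀ k : ℕ, a0 ^ k = Multiplicative.ofAdd (k : ZMod m) := by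
    intro k
    rw [← ofAdd_nsmul]; simp
  have hb0 : b0 ^ n = 1 := by
    rw [← ofAdd_nsmul]; simp
  have hAB : B * A = A ^ r * B := by
    have h := SemidirectProduct.inl_aut (φ := φ) b0 a0
    rw [hφ] at h
    have e : Multiplicative.ofAdd ((r : ZMod m) * Multiplicative.toAdd a0) = a0 ^ r := by
      rw [ha0]; simp [a0]
    rw [e, map_pow, map_inv] at h
    simp only [A, B]
    rw [h]; simp
  refine division_ring_aux n r hn (f A : D) (f B : D) ?_ ?_ ?_ ?_
  · have := congrArg (fun x => ((f x : Dˣ) : D)) hAB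
    simpa using this
  · rw [← Units.val_pow_eq_pow_val, ← map_pow, ← map_pow, hb0]; simp
  · intro h
    have h1 : f B = f 1 := by rw [map_one]; exact Units.ext h
    have h2 : b0 = 1 := SemidirectProduct.inr_injective ((hf h1).trans (map_one _).symm)
    exact one_ne_zero (α := ZMod n) (Multiplicative.ofAdd.injective h2)
  · intro s hs hsn h
    rw [← Units.val_pow_eq_pow_val, ← map_pow, ← map_pow] at h
    have h2 : a0 = a0 ^ (r ^ s) := SemidirectProduct.inl_injective (hf (Units.ext h))
    rw [ha0] at h2
    have h3 : (1 : ZMod m) = ((r ^ s : ℕ) : ZMod m) := Multiplicative.ofAdd.injective h2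
    have h4 : ZMod.unitOfCoprime r hcop ^ s = 1 := by
      ext
      simpa using h3.symm
    have := orderOf_dvd_of_pow_eq_one h4
    rw [hord] at this
    exact absurd (Nat.le_of_dvd hs this) (by omega)
end

section
/- Let D be a division ring that is a finite-dimensional ℚ-algebra with dim_ℚ D ≤ 8, and let K be the center of D; assume dim_K D = 4. Then every element of finite order in the unit group Dˣ has order belonging to the set {1, 2, 3, 4, 5, 6, 8, 10, 12}. -/
lemma mem_of_totient_dvd_four (n : ℕ) (h : n.totient ∣ 4) :
    n ∈ ({1, 2, 3, 4, 5, 6, 8, 10, 12} : Set ℕ) := by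
  have h120 : n ∣ 120 := by
    rw [Nat.dvd_iff_prime_pow_dvd_dvd]
    intro p k hp hk
    rcases Nat.eq_zero_or_pos k with rfl | hk0
    · simp
    have h1 : p ^ (k - 1) * (p - 1) ∣ 4 := by
      rw [← Nat.totient_prime_pow hp hk0]
      exact (Nat.totient_dvd_of_dvd hk).trans h
    have h2 : p - 1 ≤ 4 := Nat.le_of_dvd (by norm_num) ((Dvd.intro_left _ rfl).trans h1)
    have h3 : p ^ (k - 1) ≤ 4 := Nat.le_of_dvd (by norm_num) ((Dvd.intro _ rfl).trans h1)
    have h4 : k - 1 < 3 := by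
      by_contra hc
      have : 2 ^ 3 ≤ p ^ (k - 1) :=
        (Nat.pow_le_pow_left hp.two_le 3).trans (Nat.pow_le_pow_right hp.pos (by omega))
      omega
    have hp5 : p ≤ 5 := by omega
    have hk3 : k ≤ 3 := by omega
    have := hp.two_le
    interval_cases p <;> interval_cases k <;> revert h1 hp <;> norm_num
  have hm : n ∈ Nat.divisors 120 := by simp [h120]
  have key : ∀ m ∈ Nat.divisors 120, m.totient ∣ 4 → m ∈ ({1, 2, 3, 4, 5, 6, 8, 10, 12} : Finset ℕ) := by
    decide +kernel
  simpa using key n hm h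

theorem orderOf_unit_mem_of_quaternion_division_algebra
    (D : Type) [DivisionRing D] [Algebra ℚ D] [FiniteDimensional ℚ D]
    (hD : Module.finrank ℚ D ≤ 8)
    (hK : Module.finrank (Subalgebra.center ℚ D) D = 4)
    (x : Dˣ) (hx : IsOfFinOrder x) :
    orderOf x ∈ ({1, 2, 3, 4, 5, 6, 8, 10, 12} : Set ℕ) := by
  have hn : 0 < orderOf x := hx.orderOf_pos
  -- the dimension of `D` divides 8
  have hmulK : Module.finrank ℚ (Subalgebra.center ℚ D) * 4 = Module.finrank ℚ D := by
    letI : Field (Subalgebra.center ℚ D) := fieldOfFiniteDimensional ℚ _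
    have h1 := Module.finrank_mul_finrank ℚ (Subalgebra.center ℚ D) D
    have h2 : Module.finrank (Subalgebra.center ℚ D) D = 4 := hK
    rw [h2] at h1
    exact h1
  have hdim : Module.finrank ℚ D ∣ 8 := by
    have h3 : 0 < Module.finrank ℚ D := Module.finrank_pos
    have : Module.finrank ℚ D = 4 ∨ Module.finrank ℚ D = 8 := by omega
    rcases this with h | h <;> rw [h]
    norm_num
  set S := Algebra.adjoin ℚ {(x : D)} with hS
  letI : CommRing S := Algebra.adjoinCommRingOfComm ℚ (by
    intro a ha b hb
    rw [Set.mem_singleton_iff.1 ha, Set.mem_singleton_iff.1 hb])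
  haveI : IsDomain S := inferInstance
  letI : Field S := fieldOfFiniteDimensional ℚ S
  let y : S := ⟨x, Algebra.self_mem_adjoin_singleton ℚ (x : D)⟩
  have hy : IsPrimitiveRoot y (orderOf x) := by
    have h : orderOf y = orderOf x := by
      rw [← orderOf_units]
      exact (orderOf_injective (S.val : S →* D) Subtype.val_injective y).symm
    rw [← h]
    exact IsPrimitiveRoot.orderOf y
  haveI : NeZero ((orderOf x : ℕ) : ℚ) := ⟨Nat.cast_ne_zero.2 hn.ne'⟩
  have hmin := hy.minpoly_eq_cyclotomic_of_irreducible
    (Polynomial.cyclotomic.irreducible_rat hn)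
  have htop : Algebra.adjoin ℚ {y} = ⊤ := by
    rw [Algebra.eq_top_iff]
    rintro ⟨z, hz⟩
    have : S = (Algebra.adjoin ℚ {y}).map S.val := by
      rw [AlgHom.map_adjoin]; simp [y, hS]
    have hz' := hz
    rw [this] at hz'
    obtain ⟨w, hw, hwz⟩ := hz'
    have : w = ⟨z, hz⟩ := Subtype.ext hwz
    exact this ▸ hw
  have hint : IsIntegral ℚ y := Algebra.IsIntegral.isIntegral y
  have hfin : Module.finrank ℚ S = (orderOf x).totient := by
    let pb := PowerBasis.ofAdjoinEqTop hint htop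
    have h1 := pb.finrank
    rw [h1, ← Polynomial.natDegree_cyclotomic _ ℚ, hmin]
    simp [pb]
  have hmul := Module.finrank_mul_finrank ℚ S D
  have hdvd : (orderOf x).totient ∣ 8 := by
    rw [← hfin]
    exact (Dvd.intro _ hmul).trans hdim
  have hne : (orderOf x).totient ≠ 8 := by
    intro h8
    have hD8 : Module.finrank ℚ D = 8 := by
      have h3 : 0 < Module.finrank ℚ D := Module.finrank_pos
      have := Submodule.finrank_le (Subalgebra.toSubmodule S)
      have h2 : Module.finrank ℚ (Subalgebra.toSubmodule S) = 8 := hfin.trans h8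
      omega
    have hStop : Subalgebra.toSubmodule S = ⊤ := by
      apply Submodule.eq_top_of_finrank_eq
      rw [hD8]
      exact hfin.trans h8
    have hmem : ∀ z : D, z ∈ S := fun z => by
      have : z ∈ Subalgebra.toSubmodule S := hStop ▸ Submodule.mem_top
      exact this
    have hc : Subalgebra.center ℚ D = ⊤ := by
      rw [Algebra.eq_top_iff]
      intro z
      rw [Subalgebra.mem_center_iff]
      intro b
      have := mul_comm (⟨b, hmem b⟩ : S) ⟨z, hmem z⟩
      exact congrArg Subtype.val this
    rw [hc, (Subalgebra.topEquiv (R := ℚ) (A := D)).toLinearEquiv.finrank_eq] at hmulK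
    omega
  apply mem_of_totient_dvd_four _
  have h8 : (orderOf x).totient ∈ Nat.divisors 8 := by simp [hdvd]
  have e : Nat.divisors 8 = {1, 2, 4, 8} := by decide
  rw [e] at h8
  simp only [Finset.mem_insert, Finset.mem_singleton] at h8
  rcases h8 with h | h | h | h
  · rw [h]; norm_num
  · rw [h]; norm_num
  · rw [h]
  · exact absurd h hne
end

section
/- Let D be a division ring that is an 8-dimensional ℚ-algebra whose center K satisfies dim_ℚ K = 2. If there exists an injective group homomorphism from the dicyclic group Dic₁₆ of order 16 into the unit group Dˣ, then there exists x in K with x² = 2. -/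
theorem sqrt_two_in_center_of_dic16_embedding
    (D : Type) [DivisionRing D] [Algebra ℚ D]
    (hD : Module.finrank ℚ D = 8)
    (hK : Module.finrank ℚ (Subalgebra.center ℚ D) = 2)
    (f : QuaternionGroup 4 →* Dˣ) (hf : Function.Injective f) :
    ∃ x ∈ Subalgebra.center ℚ D, x ^ 2 = 2 := by
  obtain ⟨a, ha⟩ : ∃ a : D, a = f (.a 1) := ⟨_, rfl⟩
  obtain ⟨c, hc⟩ : ∃ c : D, c = f (.a (-1)) := ⟨_, rfl⟩
  obtain ⟨b, hb⟩ : ∃ b : D, b = f (.xa 0) := ⟨_, rfl⟩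
  have hac : a * c = 1 := by
    rw [ha, hc, ← Units.val_mul, ← map_mul, QuaternionGroup.a_mul_a]
    simp
  have hca : c * a = 1 := by
    rw [ha, hc, ← Units.val_mul, ← map_mul, QuaternionGroup.a_mul_a]
    simp
  have hab : a * b = b * c := by
    rw [ha, hc, hb, ← Units.val_mul, ← map_mul, ← Units.val_mul, ← map_mul]
    congr 2
  have hcb : c * b = b * a := by
    rw [ha, hc, hb, ← Units.val_mul, ← map_mul, ← Units.val_mul, ← map_mul]
    congr 2
  have hnab : a * b ≠ b * a := by
    rw [ha, hb, ← Units.val_mul, ← map_mul, ← Units.val_mul, ← map_mul]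
    intro h
    have := hf (Units.ext h)
    revert this
    decide
  have h4 : a * a * (a * a) = -1 := by
    have h8 : (a * a * (a * a)) * (a * a * (a * a)) = 1 := by
      rw [ha]
      simp only [← Units.val_mul, ← map_mul]
      rw [show ((QuaternionGroup.a 1 * .a 1 * (.a 1 * .a 1)) *
        (.a 1 * .a 1 * (.a 1 * .a 1)) : QuaternionGroup 4) = 1 by decide]
      simp
    have h1 : a * a * (a * a) ≠ 1 := by
      rw [ha]
      simp only [← Units.val_mul, ← map_mul]
      intro h
      have := hf ((Units.ext (h.trans (by simp))) :
        f (QuaternionGroup.a 1 * .a 1 * (.a 1 * .a 1)) = f 1)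
      revert this
      decide
    exact (mul_self_eq_one_iff.mp h8).resolve_left h1
  have hcc : c * c = -(a * a) := by
    have : c * c * (a * a * (a * a)) = a * a := by
      have : c * c * (a * a * (a * a)) = c * (c * a) * a * (a * a) := by noncomm_ring
      rw [this, hca, mul_one, hca, one_mul]
    rw [h4] at this
    rw [← this]; simp
  obtain ⟨s, hs⟩ : ∃ s : D, s = a + c := ⟨_, rfl⟩
  have hs2 : s ^ 2 = 2 := by
    rw [hs, sq, add_mul, mul_add, mul_add, hac, hca, hcc]
    rw [← one_add_one_eq_two]; abel
  have hsa : Commute s a := by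
    rw [hs]; exact (Commute.refl a).add_left (hca.trans hac.symm)
  have hsb : Commute s b := by
    rw [hs]; change (a + c) * b = b * (a + c)
    rw [add_mul, mul_add, hab, hcb, add_comm]
  refine ⟨s, ?_, hs2⟩
  by_contra hns
  let K := Subalgebra.center ℚ D
  have hKc : ∀ (k : K) (d : D), Commute (k : D) d := fun k d =>
    (Subalgebra.mem_center_iff.mp k.2 d).symm
  have key : ∀ k l : K, (k : D) + l * s = 0 → k = 0 ∧ l = 0 := by
    intro k l h
    have hl : (l : D) = 0 := by
      by_contra hl
      apply hns
      have : s = (l : D)⁻¹ * (-k) := by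
        rw [eq_inv_mul_iff_mul_eq₀ hl]
        exact (neg_eq_of_add_eq_zero_right h).symm
      rw [Subalgebra.mem_center_iff]
      intro d
      rw [this]
      exact (((hKc l d).inv_left₀).mul_left (hKc k d).neg_left).symm
    rw [hl] at h
    exact ⟨Subtype.ext (by simpa using h), Subtype.ext hl⟩
  let φ : (K × K) × (K × K) →ₗ[ℚ] D :=
    { toFun := fun p => (p.1.1 + p.1.2 * s) + (p.2.1 + p.2.2 * s) * a
      map_add' := by
        intro p q
        simp only [Prod.fst_add, Prod.snd_add, Subalgebra.coe_add, add_mul]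
        abel
      map_smul' := by
        intro r p
        simp [Algebra.smul_def, add_mul, mul_add, mul_assoc] }
  have hinj : Function.Injective φ := by
    rw [injective_iff_map_eq_zero]
    rintro ⟨⟨k, l⟩, ⟨m, n⟩⟩ h
    change ((k : D) + l * s) + (m + n * s) * a = 0 at h
    have hC : ∀ k l : K, Commute ((k : D) + l * s) b := fun k l =>
      (hKc k b).add_left ((hKc l b).mul_left hsb)
    have h2 : (m : D) + n * s = 0 := by
      by_contra hne
      apply hnab
      have : a = ((m : D) + n * s)⁻¹ * (-(k + l * s)) := by
        rw [eq_inv_mul_iff_mul_eq₀ hne]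
        exact (neg_eq_of_add_eq_zero_right h).symm
      have hh : Commute a b := by
        rw [this]
        exact ((hC m n).inv_left₀).mul_left (hC k l).neg_left
      exact hh
    rw [h2, zero_mul, add_zero] at h
    obtain ⟨rfl, rfl⟩ := key _ _ h
    obtain ⟨rfl, rfl⟩ := key _ _ h2
    rfl
  have : Module.Finite ℚ D := Module.finite_of_finrank_pos (by omega)
  have hdim : Module.finrank ℚ ((K × K) × (K × K)) = Module.finrank ℚ D := by
    have hK' : Module.finrank ℚ K = 2 := hK
    rw [Module.finrank_prod, Module.finrank_prod, hK', hD]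
  have hsurj := (LinearMap.injective_iff_surjective_of_finrank_eq_finrank hdim).mp hinj
  apply hns
  rw [Subalgebra.mem_center_iff]
  intro d
  obtain ⟨⟨⟨k, l⟩, ⟨m, n⟩⟩, rfl⟩ := hsurj d
  have hC : ∀ k l : K, Commute ((k : D) + l * s) s := fun k l =>
    (hKc k s).add_left ((hKc l s).mul_left (Commute.refl s))
  exact (hC k l).add_left ((hC m n).mul_left hsa.symm)
end

section
/- Let D be a division ring that is an 8-dimensional ℚ-algebra whose center K satisfies dim_ℚ K = 2. If there exists an injective group homomorphism from the dicyclic group Dic₂₀ of order 20 into the unit group Dˣ, then there exists x in K with x² = 5. -/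
open Polynomial in
theorem sqrt_five_in_center_of_dic20_embedding
    (D : Type) [DivisionRing D] [Algebra ℚ D]
    (hD : Module.finrank ℚ D = 8)
    (hK : Module.finrank ℚ (Subalgebra.center ℚ D) = 2)
    (f : QuaternionGroup 5 →* Dˣ) (hf : Function.Injective f) :
    ∃ x ∈ Subalgebra.center ℚ D, x ^ 2 = 5 := by
  obtain ⟨z, hz⟩ : ∃ z : D, z = ((f (QuaternionGroup.a 2) : Dˣ) : D) := ⟨_, rfl⟩
  obtain ⟨b, hb⟩ : ∃ b : D, b = ((f (QuaternionGroup.xa 0) : Dˣ) : D) := ⟨_, rfl⟩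
  have h5 : z ^ 5 = 1 := by
    rw [hz, ← Units.val_pow_eq_pow_val, ← map_pow]
    have : (QuaternionGroup.a 2 : QuaternionGroup 5) ^ 5 = 1 := by decide
    rw [this]; simp
  have h1 : z ≠ 1 := by
    intro h
    rw [hz, Units.val_eq_one, ← map_one f] at h
    exact absurd (hf h) (by decide)
  have hbz : b * z = z ^ 4 * b := by
    rw [hz, hb, ← Units.val_pow_eq_pow_val, ← map_pow, ← Units.val_mul, ← Units.val_mul,
      ← map_mul, ← map_mul]
    congr 2
  have hnc : ¬ Commute b z := by
    intro h
    have h' : b * z = z * b := h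
    rw [hz, hb, ← Units.val_mul, ← Units.val_mul, ← map_mul, ← map_mul] at h'
    exact absurd (hf (Units.ext h')) (by decide)
  have hphi : aeval z (cyclotomic 5 ℚ) = 0 := by
    have h : (cyclotomic 5 ℚ) * (X - 1) = X ^ 5 - 1 :=
      haveI : Fact (Nat.Prime 5) := ⟨by norm_num⟩
      cyclotomic_prime_mul_X_sub_one ℚ 5
    have h2 := congrArg (aeval z) h
    simp only [map_mul, map_sub, map_pow, aeval_X, map_one, h5, sub_self] at h2
    exact (mul_eq_zero.mp h2).resolve_right (sub_ne_zero.mpr h1)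
  have hdeg : (cyclotomic 5 ℚ).degree = 4 := by
    rw [degree_cyclotomic]; decide
  have hinj : ∀ p : ℚ[X], p ∈ degreeLT ℚ 4 → aeval z p = 0 → p = 0 := by
    intro p hp h0
    by_contra hne
    have hirr : Irreducible (cyclotomic 5 ℚ) := cyclotomic.irreducible_rat (by norm_num)
    have hnd : ¬ cyclotomic 5 ℚ ∣ p := by
      intro hd
      have := degree_le_of_dvd hd hne
      rw [hdeg] at this
      exact absurd (mem_degreeLT.mp hp) (not_lt.mpr this)
    obtain ⟨u, v, huv⟩ := (hirr.coprime_iff_not_dvd).mpr hnd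
    have := congrArg (aeval z) huv
    simp [hphi, h0] at this
  have hcz : ∀ p : ℚ[X], Commute (aeval z p) z := fun p => by
    have h := congrArg (aeval z) (mul_comm p X)
    simp only [map_mul, aeval_X] at h
    exact h
  let L : (degreeLT ℚ 4 × degreeLT ℚ 4) →ₗ[ℚ] D :=
    LinearMap.coprod ((aeval z).toLinearMap ∘ₗ (degreeLT ℚ 4).subtype)
      (LinearMap.mulRight ℚ b ∘ₗ (aeval z).toLinearMap ∘ₗ (degreeLT ℚ 4).subtype)
  have hL : ∀ x, L x = aeval z (x.1 : ℚ[X]) + aeval z (x.2 : ℚ[X]) * b := fun x => by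
    simp [L]
  have hLinj : Function.Injective L := by
    rw [injective_iff_map_eq_zero]
    rintro ⟨⟨p, hp⟩, ⟨q, hq⟩⟩ h
    rw [hL] at h
    simp only at h
    have hq0 : aeval z q = 0 := by
      by_contra hne
      apply hnc
      have : b = (aeval z q)⁻¹ * (- aeval z p) := by
        rw [eq_inv_mul_iff_mul_eq₀ hne]
        exact eq_neg_of_add_eq_zero_right h
      rw [this]
      exact ((hcz q).inv_left₀).mul_left (hcz p).neg_left
    rw [hq0, zero_mul, add_zero] at h
    have e1 := hinj p hp h
    have e2 := hinj q hq hq0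
    subst e1 e2
    rfl
  haveI : FiniteDimensional ℚ D := Module.finite_of_finrank_pos (by omega)
  haveI : FiniteDimensional ℚ (degreeLT ℚ 4) :=
    Module.Finite.equiv (degreeLTEquiv ℚ 4).symm
  have hr : Module.finrank ℚ (degreeLT ℚ 4) = 4 := by
    rw [(degreeLTEquiv ℚ 4).finrank_eq]; simp
  have hsurj : Function.Surjective L := by
    rw [← LinearMap.injective_iff_surjective_of_finrank_eq_finrank]
    · exact hLinj
    · rw [Module.finrank_prod, hr, hD]
  have hs : aeval z (2 * (X + X ^ 4) + 1 : ℚ[X]) = 2 * (z + z ^ 4) + 1 := by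
    have h2 : aeval z (2 : ℚ[X]) = 2 := map_ofNat (aeval z) 2
    simp [h2]
  have hbs : Commute b (2 * (z + z ^ 4) + 1) := by
    have h16 : b * z ^ 4 = z * b := by
      have e : SemiconjBy b z (z ^ 4) := hbz
      have := (e.pow_right 4).eq
      rw [this, ← pow_mul, show 4 * 4 = 5 * 3 + 1 from rfl, pow_succ, pow_mul, h5]
      simp
    have : Commute b (z + z ^ 4) := by
      change b * (z + z ^ 4) = (z + z ^ 4) * b
      rw [mul_add, add_mul, hbz, h16, add_comm]
    exact (Commute.mul_right (Commute.ofNat_right b 2) this).add_right (Commute.one_right b)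
  refine ⟨2 * (z + z ^ 4) + 1, ?_, ?_⟩
  · rw [Subalgebra.mem_center_iff]
    intro d
    obtain ⟨⟨p, q⟩, rfl⟩ := hsurj d
    rw [hL]
    have hc : ∀ p : ℚ[X], Commute (aeval z p) (2 * (z + z ^ 4) + 1) := fun p => by
      rw [← hs]
      exact (Commute.all p _).map (aeval z)
    exact (hc _).add_left ((hc _).mul_left hbs)
  · have h : (2 * (X + X ^ 4) + 1 : ℚ[X]) ^ 2
        = cyclotomic 5 ℚ * (4 * X ^ 4 - 4 * X ^ 3 + 8 * X - 4) + 5 := by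
      haveI : Fact (Nat.Prime 5) := ⟨by norm_num⟩
      rw [cyclotomic_prime]
      simp only [Finset.sum_range_succ, Finset.sum_range_zero]
      ring
    have h2 := congrArg (aeval z) h
    rw [map_pow, hs, map_add, map_mul, hphi, zero_mul, zero_add] at h2
    rw [h2]
    exact map_ofNat (aeval z) 5
end

section
/- Let K be an imaginary quadratic field, i.e. a field with dim_ℚ K = 2 admitting no ring homomorphism into ℝ. If A is an invertible 2×2 matrix over K of finite order e ≥ 1, then e belongs to the set {1, 2, 3, 4, 6, 8, 12}. -/
open Polynomial in
theorem aux_natDegree_minpoly_le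
    (K : Type) [Field K] [Algebra ℚ K] (hdim : Module.finrank ℚ K = 2)
    (M : Matrix (Fin 2) (Fin 2) K) : (minpoly ℚ M).natDegree ≤ 4 := by
  have : FiniteDimensional ℚ K := Module.finite_of_finrank_pos (by omega)
  let φ : Matrix (Fin 2) (Fin 2) K →ₐ[ℚ] Module.End ℚ (Fin 2 → K) :=
    (Algebra.lsmul ℚ ℚ (Fin 2 → K)).comp
      ((Matrix.toLinAlgEquiv' (R := K) (n := Fin 2)).toAlgHom.restrictScalars ℚ)
  have hφ : Function.Injective φ := by
    intro M N h
    apply (Matrix.toLinAlgEquiv' (R := K) (n := Fin 2)).injective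
    apply LinearMap.ext
    intro v
    exact congrArg (fun f => f v) h
  rw [← minpoly.algHom_eq φ hφ M]
  have h1 := natDegree_le_of_dvd (LinearMap.minpoly_dvd_charpoly (φ M))
    (LinearMap.charpoly_monic (φ M)).ne_zero
  rw [LinearMap.charpoly_natDegree] at h1
  have h2 : Module.finrank ℚ (Fin 2 → K) = 4 := by
    rw [Module.finrank_pi_fintype]
    simp [hdim]
  omega

open Polynomial in
theorem aux_cyclotomic_dvd {B : Type} [Ring B] [Algebra ℚ B] (b : B) (p k : ℕ)
    [Fact p.Prime] (hb : orderOf b = p ^ (k + 1)) :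
    cyclotomic (p ^ (k + 1)) ℚ ∣ minpoly ℚ b := by
  by_contra hn
  have hp : p.Prime := Fact.out
  have hcop := ((cyclotomic.irreducible_rat (n := p ^ (k + 1))
    (pow_pos hp.pos _)).coprime_iff_not_dvd).2 hn
  have h1 : minpoly ℚ b ∣ cyclotomic (p ^ (k + 1)) ℚ * (X ^ p ^ k - 1) := by
    rw [cyclotomic_prime_pow_mul_X_pow_sub_one]
    apply minpoly.dvd
    simp [← hb, pow_orderOf_eq_one]
  have h2 := hcop.symm.dvd_of_dvd_mul_left h1
  have h3 := (minpoly.dvd_iff).1 h2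
  have h4 : b ^ p ^ k = 1 := by simpa [sub_eq_zero] using h3
  have h5 := orderOf_dvd_of_pow_eq_one h4
  rw [hb] at h5
  have := (Nat.pow_dvd_pow_iff_le_right hp.one_lt).1 h5
  omega

open Polynomial in
theorem aux_totient_le
    (K : Type) [Field K] [Algebra ℚ K] (hdim : Module.finrank ℚ K = 2)
    (M : Matrix (Fin 2) (Fin 2) K) (p k : ℕ) (hp : p.Prime)
    (hM : orderOf M = p ^ (k + 1)) : p ^ k * (p - 1) ≤ 4 := by
  have : FiniteDimensional ℚ K := Module.finite_of_finrank_pos (by omega)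
  have : Fact p.Prime := ⟨hp⟩
  have h := natDegree_le_of_dvd (aux_cyclotomic_dvd M p k hM)
    (minpoly.ne_zero (Algebra.IsIntegral.isIntegral M))
  rw [natDegree_cyclotomic, Nat.totient_prime_pow_succ hp] at h
  exact h.trans (aux_natDegree_minpoly_le K hdim M)

open Polynomial in
theorem aux_eq_cyclotomic
    (K : Type) [Field K] [Algebra ℚ K] (hdim : Module.finrank ℚ K = 2)
    (M : Matrix (Fin 2) (Fin 2) K) (p k : ℕ) (hp : p.Prime)
    (hM : orderOf M = p ^ (k + 1)) (h4 : p ^ k * (p - 1) = 4) :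
    aeval M (cyclotomic (p ^ (k + 1)) ℚ) = 0 := by
  have : FiniteDimensional ℚ K := Module.finite_of_finrank_pos (by omega)
  have : Fact p.Prime := ⟨hp⟩
  have h := eq_of_monic_of_dvd_of_natDegree_le (cyclotomic.monic _ ℚ)
    (minpoly.monic (Algebra.IsIntegral.isIntegral M)) (aux_cyclotomic_dvd M p k hM) (by
      rw [natDegree_cyclotomic, Nat.totient_prime_pow_succ hp, h4]
      exact aux_natDegree_minpoly_le K hdim M)
  rw [← h, minpoly.aeval]

open Polynomial in
theorem aux_not_24
    (K : Type) [Field K] [Algebra ℚ K] (hdim : Module.finrank ℚ K = 2)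
    (M : Matrix (Fin 2) (Fin 2) K) (hM : orderOf M = 24) : False := by
  have : FiniteDimensional ℚ K := Module.finite_of_finrank_pos (by omega)
  have h3 : orderOf (M ^ 3) = 2 ^ (2 + 1) := by
    rw [orderOf_pow_of_dvd (by norm_num) (by rw [hM]; norm_num), hM]
    norm_num
  have h8 : cyclotomic (2 ^ (2 + 1)) ℚ = X ^ 4 + 1 := by
    rw [cyclotomic_prime_pow_eq_geom_sum Nat.prime_two]
    simp [Finset.sum_range_succ, add_comm]
  have h := aux_eq_cyclotomic K hdim (M ^ 3) 2 2 Nat.prime_two h3 (by norm_num)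
  rw [h8] at h
  have h12 : M ^ 12 + 1 = 0 := by
    simpa [← pow_mul] using h
  have hexp := cyclotomic_expand_eq_cyclotomic_mul Nat.prime_three
    (n := 2 ^ (2 + 1)) (by norm_num) ℚ
  rw [h8] at hexp
  have hd : minpoly ℚ M ∣ cyclotomic ((2 ^ (2 + 1)) * 3) ℚ * (X ^ 4 + 1) := by
    rw [← hexp]
    apply minpoly.dvd
    simpa [← pow_mul] using h12
  have hnd : ¬ cyclotomic ((2 ^ (2 + 1)) * 3) ℚ ∣ minpoly ℚ M := by
    intro hdvd
    have h := natDegree_le_of_dvd hdvd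
      (minpoly.ne_zero (Algebra.IsIntegral.isIntegral M))
    rw [natDegree_cyclotomic] at h
    have h' := h.trans (aux_natDegree_minpoly_le K hdim M)
    revert h'
    decide
  have hcop := ((cyclotomic.irreducible_rat (n := (2 ^ (2 + 1)) * 3)
    (by norm_num)).coprime_iff_not_dvd).2 hnd
  have h2 := minpoly.dvd_iff.1 (hcop.symm.dvd_of_dvd_mul_left hd)
  have h4 : M ^ 4 = -1 := by
    rw [← add_eq_zero_iff_eq_neg]
    simpa using h2
  have h5 : M ^ 8 = 1 := by
    rw [show 8 = 4 * 2 from rfl, pow_mul, h4]; simp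
  have := orderOf_dvd_of_pow_eq_one h5
  rw [hM] at this
  revert this
  decide

open Polynomial in
theorem aux_real
    (K : Type) [Field K] [Algebra ℚ K] (hdim : Module.finrank ℚ K = 2)
    (s : K) (hs : s ^ 2 = 5) : Nonempty (K →+* ℝ) := by
  have : FiniteDimensional ℚ K := Module.finite_of_finrank_pos (by omega)
  have hso := IntermediateField.isSimpleOrder_of_finrank_prime ℚ K
    (by rw [hdim]; exact Nat.prime_two)
  have htop : IntermediateField.adjoin ℚ {s} = ⊤ := by
    rcases hso.eq_bot_or_eq_top (IntermediateField.adjoin ℚ {s}) with h | h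
    · exfalso
      rw [IntermediateField.adjoin_simple_eq_bot_iff, IntermediateField.mem_bot] at h
      obtain ⟨q, rfl⟩ := h
      have hq : q ^ 2 = 5 := by
        apply (algebraMap ℚ K).injective
        simpa using hs
      have hirr : Irrational (√((5 : ℕ) : ℝ)) := Nat.Prime.irrational_sqrt (by norm_num)
      apply hirr
      refine ⟨|q|, ?_⟩
      have : ((5 : ℕ) : ℝ) = (q : ℝ) ^ 2 := by
        rw [← Rat.cast_pow, hq]; norm_num
      rw [this, Real.sqrt_sq_eq_abs]
      simp
    · exact h
  obtain ⟨f⟩ := IntermediateField.nonempty_algHom_of_adjoin_splits (F := ℚ) (E := K) (K := ℝ)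
    (S := {s}) (by
      rintro x rfl
      refine ⟨Algebra.IsIntegral.isIntegral _, ?_⟩
      have h1 : minpoly ℚ x ∣ X ^ 2 - 5 := by
        apply minpoly.dvd
        rw [map_sub, map_pow, aeval_X, map_ofNat, hs, sub_self]
      have h2 := Polynomial.map_dvd (algebraMap ℚ ℝ) h1
      have h3 : Polynomial.map (algebraMap ℚ ℝ) (X ^ 2 - 5) = (X - C (√5)) * (X + C (√5)) := by
        have h5 : (C (√5) : ℝ[X]) ^ 2 = 5 := by
          rw [← C_pow, Real.sq_sqrt (by norm_num)]; rfl
        simp only [Polynomial.map_sub, Polynomial.map_pow, Polynomial.map_X,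
          Polynomial.map_ofNat]
        linear_combination h5
      rw [h3] at h2
      refine Splits.of_dvd ?_ ?_ h2
      · exact (Splits.X_sub_C _).mul (Splits.X_add_C _)
      · exact ((monic_X_sub_C _).mul (monic_X_add_C _)).ne_zero) htop
  exact ⟨f.toRingHom⟩

open Polynomial in
theorem aux_not_5
    (K : Type) [Field K] [Algebra ℚ K] (hdim : Module.finrank ℚ K = 2)
    (hreal : IsEmpty (K →+* ℝ))
    (M : Matrix (Fin 2) (Fin 2) K) (hM : orderOf M = 5) : False := by
  have : FiniteDimensional ℚ K := Module.finite_of_finrank_pos (by omega)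
  have hF : Fact (Nat.Prime 5) := ⟨by norm_num⟩
  have h := aux_eq_cyclotomic K hdim M 5 0 (by norm_num) (by simpa using hM) (by norm_num)
  rw [show 5 ^ (0 + 1) = 5 from rfl, cyclotomic_prime] at h
  have hA : 1 + M + M ^ 2 + M ^ 3 + M ^ 4 = 0 := by
    simpa [Finset.sum_range_succ] using h
  have h5 : M ^ 5 = 1 := by rw [← hM]; exact pow_orderOf_eq_one M
  have hd5 : M.det ^ 5 = 1 := by rw [← Matrix.det_pow, h5, Matrix.det_one]
  have hd : M.det = 1 := by
    by_contra hne
    have ho : orderOf M.det = 5 ^ (0 + 1) := by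
      rw [zero_add, pow_one]
      exact orderOf_eq_prime hd5 hne
    have h1 := natDegree_le_of_dvd (aux_cyclotomic_dvd M.det 5 0 ho)
      (minpoly.ne_zero (Algebra.IsIntegral.isIntegral M.det))
    rw [natDegree_cyclotomic, Nat.totient_prime_pow_succ hF.out] at h1
    have h2 := minpoly.natDegree_le (A := ℚ) M.det
    omega
  have hCH : M ^ 2 = M.trace • M - 1 := by
    rw [Matrix.det_fin_two] at hd
    ext i j
    fin_cases i <;> fin_cases j <;>
      simp [pow_two, Matrix.mul_apply, Fin.sum_univ_two, Matrix.trace_fin_two] <;>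
      first | linear_combination -hd | ring
  set t := M.trace with ht
  have h3 : M ^ 3 = t • M ^ 2 - M := by
    rw [pow_succ, hCH]; simp [sub_mul]
    rw [← pow_two, hCH]
  have h4 : M ^ 4 = t • M ^ 3 - M ^ 2 := by
    rw [pow_succ, h3]; simp [sub_mul, ← pow_succ, ← pow_two]
    rw [← h3]
  have key : (t ^ 2 + t - 1) • M ^ 2 = 0 := by
    have e1 : t • M = M ^ 2 + 1 := by rw [hCH]; simp
    have e2 : t • M ^ 3 = (t ^ 2) • M ^ 2 - t • M := by
      rw [h3, smul_sub, smul_smul, ← pow_two t]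
    rw [← hA, h4, e2, h3, sub_smul, add_smul, e1, one_smul]
    abel
  have hu : IsUnit (M ^ 2) := (IsUnit.of_pow_eq_one h5 (by norm_num)).pow 2
  have hne : M ^ 2 ≠ 0 := hu.ne_zero
  have ht2 : t ^ 2 + t - 1 = 0 := (smul_eq_zero.1 key).resolve_right hne
  obtain ⟨f⟩ := aux_real K hdim (2 * t + 1) (by linear_combination 4 * ht2)
  exact hreal.false f

theorem orderOf_GL2_imaginary_quadratic
    (K : Type) [Field K] [Algebra ℚ K] (hdim : Module.finrank ℚ K = 2)
    (hreal : IsEmpty (K →+* ℝ))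
    (A : Matrix.GeneralLinearGroup (Fin 2) K) (e : ℕ) (he : 1 ≤ e)
    (hA : IsOfFinOrder A) (horder : orderOf A = e) :
    e ∈ ({1, 2, 3, 4, 6, 8, 12} : Set ℕ) := by
  have hM : orderOf (A : Matrix (Fin 2) (Fin 2) K) = e := by rw [← horder]; exact orderOf_units
  generalize (A : Matrix (Fin 2) (Fin 2) K) = M at hM
  -- powers realise every divisor of the order
  have hdvd : ∀ d : ℕ, d ∣ e → ∃ N : Matrix (Fin 2) (Fin 2) K, orderOf N = d := by
    rintro d ⟨c, rfl⟩
    have hc : 0 < c := Nat.pos_of_ne_zero (by rintro rfl; simp at he)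
    refine ⟨M ^ c, ?_⟩
    rw [orderOf_pow_of_dvd hc.ne' (by rw [hM]; exact Dvd.intro_left d rfl), hM,
      Nat.mul_div_cancel _ hc]
  have hpp : ∀ p k : ℕ, p.Prime → p ^ (k + 1) ∣ e → p ^ k * (p - 1) ≤ 4 := by
    intro p k hp h
    obtain ⟨N, hN⟩ := hdvd _ h
    exact aux_totient_le K hdim N p k hp hN
  have h16 : ¬ 2 ^ 4 ∣ e := fun h => by
    have := hpp 2 3 Nat.prime_two h
    norm_num at this
  have h9 : ¬ 3 ^ 2 ∣ e := fun h => by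
    have := hpp 3 1 Nat.prime_three h
    norm_num at this
  have h5 : ¬ 5 ∣ e := fun h => by
    obtain ⟨N, hN⟩ := hdvd _ h
    exact aux_not_5 K hdim hreal N hN
  have hprime : ∀ p : ℕ, p.Prime → p ∣ e → p = 2 ∨ p = 3 := by
    intro p hp h
    have h1 := hpp p 0 hp (by simpa using h)
    have h2 : p ≤ 5 := by simp at h1; omega
    interval_cases p
    · exact absurd hp (by norm_num)
    · exact absurd hp (by norm_num)
    · simp
    · simp
    · exact absurd hp (by norm_num)
    · exact absurd h h5
  have h24 : e ∣ 24 := by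
    rw [← Nat.factorization_prime_le_iff_dvd (by omega) (by norm_num)]
    intro p hp
    by_cases hpe : p ∣ e
    · rcases hprime p hp hpe with rfl | rfl
      · have a1 : e.factorization 2 < 4 := by
          by_contra hlt
          exact h16 ((Nat.prime_two.pow_dvd_iff_le_factorization (by omega)).2 (by omega))
        have a2 : 3 ≤ Nat.factorization 24 2 :=
          (Nat.prime_two.pow_dvd_iff_le_factorization (by norm_num)).1 (by norm_num)
        omega
      · have a1 : e.factorization 3 < 2 := by
          by_contra hlt
          exact h9 ((Nat.prime_three.pow_dvd_iff_le_factorization (by omega)).2 (by omega))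
        have a2 : 1 ≤ Nat.factorization 24 3 :=
          (Nat.prime_three.pow_dvd_iff_le_factorization (by norm_num)).1 (by norm_num)
        omega
    · rw [Nat.factorization_eq_zero_of_not_dvd hpe]
      exact Nat.zero_le _
  have hne : e ≠ 24 := by
    rintro rfl
    exact aux_not_24 K hdim M hM
  have hle := Nat.le_of_dvd (by norm_num) h24
  simp only [Set.mem_insert_iff, Set.mem_singleton_iff]
  interval_cases e <;> simp_all
end

section
/- Let K be the subfield of ℂ generated over ℚ by √5 and √(−2) (i.e. by the real number √5 and the complex number i·√2). Then the only roots of unity in K are 1 and −1: if z ∈ K satisfies zⁿ = 1 for some positive integer n, then z = 1 or z = −1. -/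
lemma aux_sq (q : ℚ) (n : ℕ) (h : q ^ 2 = n) : IsSquare n := by
  rw [← Rat.isSquare_natCast_iff]
  exact ⟨q, by rw [← h]; ring⟩

lemma aux_s5 : (Real.sqrt 5) ^ 2 = 5 := Real.sq_sqrt (by norm_num)
lemma aux_s2 : (Real.sqrt 2) ^ 2 = 2 := Real.sq_sqrt (by norm_num)

/-- `1` and `√5` are independent over `ℚ`. -/
lemma aux_indep (x y : ℚ) (h : (x : ℝ) + y * Real.sqrt 5 = 0) : x = 0 ∧ y = 0 := by
  have h5 := aux_s5
  have hy : y = 0 := by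
    by_contra hy
    have h1 : x ^ 2 = 5 * y ^ 2 := by
      have : (x : ℝ) ^ 2 = 5 * (y : ℝ) ^ 2 := by
        have : (x : ℝ) = -(y * Real.sqrt 5) := by linarith
        rw [this, neg_sq, mul_pow, h5]; ring
      exact_mod_cast this
    have h2 : (x / y) ^ 2 = ((5 : ℕ) : ℚ) := by
      field_simp; push_cast; linarith
    have := aux_sq _ _ h2
    obtain ⟨r, hr⟩ := this; have : r < 6 := by { by_contra hc; nlinarith }
    interval_cases r <;> omega
  subst hy
  simpa using h

/-- Coordinates. -/
lemma aux_coord (z : ℂ)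
    (hz : z ∈ IntermediateField.adjoin ℚ
      ({(Real.sqrt 5 : ℂ), Complex.I * (Real.sqrt 2 : ℂ)} : Set ℂ)) :
    ∃ a b c d : ℚ, z.re = a + b * Real.sqrt 5 ∧ z.im = Real.sqrt 2 * (c + d * Real.sqrt 5) := by
  have h5 := aux_s5
  have h2 := aux_s2
  have h5c : (Real.sqrt 5 : ℂ) ^ 2 = 5 := by exact_mod_cast h5
  have h2c : (Real.sqrt 2 : ℂ) ^ 2 = 2 := by exact_mod_cast h2
  have halg : ∀ x ∈ ({(Real.sqrt 5 : ℂ), Complex.I * (Real.sqrt 2 : ℂ)} : Set ℂ),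
      IsAlgebraic ℚ x := by
    intro x hx
    apply IsIntegral.isAlgebraic
    apply IsIntegral.of_pow (n := 2) (by norm_num)
    rcases hx with rfl | hx
    · rw [h5c]; exact_mod_cast (isIntegral_algebraMap (R := ℚ) (A := ℂ) (x := 5))
    · rw [Set.mem_singleton_iff] at hx
      rw [hx, mul_pow, h2c, Complex.I_sq]
      have := (isIntegral_algebraMap (R := ℚ) (A := ℂ) (x := -2))
      simpa using this
  rw [← IntermediateField.mem_toSubalgebra,
    IntermediateField.adjoin_toSubalgebra_of_isAlgebraic halg] at hz
  induction hz using Algebra.adjoin_induction with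
  | mem x hx =>
    rcases hx with rfl | hx
    · exact ⟨0, 1, 0, 0, by simp, by simp⟩
    · rw [Set.mem_singleton_iff] at hx
      exact ⟨0, 0, 1, 0, by simp [hx], by simp [hx]⟩
  | algebraMap r => exact ⟨r, 0, 0, 0, by simp, by simp⟩
  | add x y _ _ hx hy =>
    obtain ⟨a, b, c, d, h, k⟩ := hx
    obtain ⟨a', b', c', d', h', k'⟩ := hy
    refine ⟨a + a', b + b', c + c', d + d', ?_, ?_⟩
    · rw [Complex.add_re, h, h']; push_cast; ring
    · rw [Complex.add_im, k, k']; push_cast; ring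
  | mul x y _ _ hx hy =>
    obtain ⟨a, b, c, d, h, k⟩ := hx
    obtain ⟨a', b', c', d', h', k'⟩ := hy
    refine ⟨a * a' + 5 * b * b' - 2 * (c * c' + 5 * d * d'),
      a * b' + b * a' - 2 * (c * d' + d * c'),
      a * c' + 5 * b * d' + (c * a' + 5 * d * b'),
      a * d' + b * c' + c * b' + d * a', ?_, ?_⟩
    · rw [Complex.mul_re, h, h', k, k']; push_cast
      generalize Real.sqrt 5 = s at *
      generalize Real.sqrt 2 = t at *
      linear_combination (b * b' - d * d' * t ^ 2 : ℝ) * h5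
        - (c * c' + 5 * d * d' + (c * d' + d * c') * s : ℝ) * h2
    · rw [Complex.mul_im, h, h', k, k']; push_cast
      generalize Real.sqrt 5 = s at *
      generalize Real.sqrt 2 = t at *
      linear_combination (t * (b * d' + d * b') : ℝ) * h5

/-- A rational quartic vanishing at `z`. -/
lemma aux_deg (z : ℂ) (a b c d : ℚ) (hre : z.re = a + b * Real.sqrt 5)
    (him : z.im = Real.sqrt 2 * (c + d * Real.sqrt 5)) :
    (minpoly ℚ z).natDegree ≤ 4 := by
  have h5c : (Real.sqrt 5 : ℂ) ^ 2 = 5 := by exact_mod_cast aux_s5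
  have h2c : (Real.sqrt 2 : ℂ) ^ 2 = 2 := by exact_mod_cast aux_s2
  have hI := Complex.I_sq
  have hz : z = (a + b * (Real.sqrt 5 : ℂ)) +
      (Real.sqrt 2 : ℂ) * (c + d * (Real.sqrt 5 : ℂ)) * Complex.I := by
    rw [← Complex.re_add_im z, hre, him]; push_cast; ring
  -- `z ^ 2 - 2 A z + N = 0` with `A = a + b √5`, `N = m + k √5`
  let m : ℚ := a ^ 2 + 5 * b ^ 2 + 2 * (c ^ 2 + 5 * d ^ 2)
  let k : ℚ := 2 * a * b + 4 * c * d
  have hq : z ^ 2 - 2 * a * z + m = (Real.sqrt 5 : ℂ) * (2 * b * z - k) := by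
    simp only [m, k]
    push_cast
    rw [hz]
    generalize (Real.sqrt 5 : ℂ) = s at *
    generalize (Real.sqrt 2 : ℂ) = t at *
    generalize Complex.I = i at *
    linear_combination (-(b : ℂ) ^ 2 - 2 * d ^ 2) * h5c + (c + d * s : ℂ) ^ 2 * i ^ 2 * h2c
      + 2 * (c + d * s : ℂ) ^ 2 * hI
  let P : Polynomial ℚ := (Polynomial.X ^ 2 - Polynomial.C (2 * a) * Polynomial.X
    + Polynomial.C m) ^ 2 - Polynomial.C 5 * (Polynomial.C (2 * b) * Polynomial.X
    - Polynomial.C k) ^ 2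
  have hdeg : P.natDegree = 4 := by simp only [P]; compute_degree!
  have hP0 : P ≠ 0 := by intro h; rw [h] at hdeg; simp at hdeg
  have hPz : Polynomial.aeval z P = 0 := by
    simp only [P, map_sub, map_add, map_mul, map_pow, Polynomial.aeval_X, Polynomial.aeval_C,
      eq_ratCast]
    push_cast
    rw [hq, mul_pow, h5c]; ring
  rw [← hdeg]
  exact Polynomial.natDegree_le_of_dvd (minpoly.dvd ℚ z hPz) hP0

lemma aux_half (c d r : ℚ) (h : ((c : ℝ) + d * Real.sqrt 5) ^ 2 = r) :
    c ^ 2 = r ∨ 5 * d ^ 2 = r := by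
  have h5 := aux_s5
  have := aux_indep (c ^ 2 + 5 * d ^ 2 - r) (2 * c * d) (by
    push_cast; linear_combination h - (d : ℝ) ^ 2 * h5)
  obtain ⟨h1, h2⟩ := this
  have : c = 0 ∨ d = 0 := by simpa using h2
  rcases this with rfl | rfl
  · right; linarith
  · left; linarith

lemma aux_no4 (z : ℂ) (a b c d : ℚ) (hre : z.re = a + b * Real.sqrt 5)
    (him : z.im = Real.sqrt 2 * (c + d * Real.sqrt 5)) (h : z ^ 2 = -1) : False := by
  have h2 := aux_s2
  have e1 := congrArg Complex.re h
  have e2 := congrArg Complex.im h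
  simp [pow_two] at e1 e2
  have hi : z.im ≠ 0 := by intro h0; rw [h0] at e1; nlinarith [sq_nonneg z.re]
  have hr : z.re = 0 := by
    have : z.re * z.im = 0 := by linarith
    exact (mul_eq_zero.1 this).resolve_right hi
  rw [hr, him] at e1
  rcases aux_half c d (1 / 2) (by
    push_cast; linear_combination -e1 / 2 - (c + d * Real.sqrt 5 : ℝ) ^ 2 / 2 * h2) with h | h
  · have := aux_sq (2 * c) 2 (by push_cast; linarith)
    obtain ⟨r, hr⟩ := this; have : r < 6 := by { by_contra hc; nlinarith }
    interval_cases r <;> omega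
  · have := aux_sq (10 * d) 10 (by push_cast; linarith)
    obtain ⟨r, hr⟩ := this; have : r < 6 := by { by_contra hc; nlinarith }
    interval_cases r <;> omega

lemma aux_no3 (z : ℂ) (a b c d : ℚ) (hre : z.re = a + b * Real.sqrt 5)
    (him : z.im = Real.sqrt 2 * (c + d * Real.sqrt 5)) (h : z ^ 2 + z + 1 = 0) : False := by
  have h2 := aux_s2
  have e1 := congrArg Complex.re h
  have e2 := congrArg Complex.im h
  simp [pow_two] at e1 e2
  have hi : z.im ≠ 0 := by intro h0; rw [h0] at e1; nlinarith [sq_nonneg (2 * z.re + 1)]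
  have hr : z.re = -1 / 2 := by
    have : (2 * z.re + 1) * z.im = 0 := by linarith
    have := (mul_eq_zero.1 this).resolve_right hi
    linarith
  rw [hr, him] at e1
  rcases aux_half c d (3 / 8) (by
    push_cast; linear_combination -e1 / 2 - (c + d * Real.sqrt 5 : ℝ) ^ 2 / 2 * h2) with h | h
  · have := aux_sq (4 * c) 6 (by push_cast; linarith)
    obtain ⟨r, hr⟩ := this; have : r < 6 := by { by_contra hc; nlinarith }
    interval_cases r <;> omega
  · have := aux_sq (20 * d) 30 (by push_cast; linarith)
    obtain ⟨r, hr⟩ := this; have : r < 6 := by { by_contra hc; nlinarith }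
    interval_cases r <;> omega

lemma aux_no5 (z : ℂ) (a b c d : ℚ) (hre : z.re = a + b * Real.sqrt 5)
    (him : z.im = Real.sqrt 2 * (c + d * Real.sqrt 5)) (h5z : z ^ 5 = 1) (h1z : z ≠ 1) :
    False := by
  have h2 := aux_s2
  have h5 := aux_s5
  have hn : ‖z‖ = 1 := Complex.norm_eq_one_of_pow_eq_one h5z (by norm_num)
  have hN : z.re * z.re + z.im * z.im = 1 := by
    rw [← Complex.normSq_apply, Complex.normSq_eq_norm_sq, hn]; norm_num
  have hzc : z * (starRingEnd ℂ) z = 1 := by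
    rw [Complex.mul_conj, Complex.normSq_apply, hN]; simp
  have hs : z ^ 4 + z ^ 3 + z ^ 2 + z + 1 = 0 := by
    have : (z - 1) * (z ^ 4 + z ^ 3 + z ^ 2 + z + 1) = 0 := by linear_combination h5z
    exact (mul_eq_zero.1 this).resolve_left (sub_ne_zero.2 h1z)
  have hu : (z + (starRingEnd ℂ) z) ^ 2 + (z + (starRingEnd ℂ) z) - 1 = 0 := by
    generalize (starRingEnd ℂ) z = w at *
    have hz0 : z ≠ 0 := by rintro rfl; simp at hzc
    have hw : w = z⁻¹ := eq_inv_of_mul_eq_one_right hzc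
    rw [hw]; field_simp; linear_combination hs
  rw [Complex.add_conj] at hu
  have hA : (2 * z.re) ^ 2 + 2 * z.re - 1 = 0 := by exact_mod_cast hu
  rw [hre] at hA
  obtain ⟨g1, g2⟩ := aux_indep (4 * (a ^ 2 + 5 * b ^ 2) + 2 * a - 1) (8 * a * b + 2 * b) (by
    push_cast; linear_combination hA - 4 * (b : ℝ) ^ 2 * h5)
  rw [hre, him] at hN
  obtain ⟨g3, g4⟩ := aux_indep (a ^ 2 + 5 * b ^ 2 + 2 * (c ^ 2 + 5 * d ^ 2) - 1)
    (2 * a * b + 4 * c * d) (by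
      push_cast
      linear_combination hN - ((b : ℝ) ^ 2 + 2 * d ^ 2) * h5
        - (c + d * Real.sqrt 5 : ℝ) ^ 2 * h2)
  have : b = 0 ∨ a = -1 / 4 := by
    have : b * (4 * a + 1) = 0 := by linarith
    rcases mul_eq_zero.1 this with h | h
    · exact Or.inl h
    · right; linarith
  rcases this with rfl | rfl
  · have := aux_sq (4 * a + 1) 5 (by push_cast; linarith)
    obtain ⟨r, hr⟩ := this; have : r < 6 := by { by_contra hc; nlinarith }
    interval_cases r <;> omega
  · have hb : b ^ 2 = 1 / 16 := by linarith
    have hcd : c * d = b / 8 := by linarith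
    have hc : c ^ 2 + 5 * d ^ 2 = 5 / 16 := by linarith
    have := aux_sq (8 * (c ^ 2 - 5 * d ^ 2)) 5 (by
      push_cast
      linear_combination 64 * (c ^ 2 + 5 * d ^ 2 + 5 / 16) * hc
        - 1280 * (c * d + b / 8) * hcd - 20 * hb)
    obtain ⟨r, hr⟩ := this; have : r < 6 := by { by_contra hc; nlinarith }
    interval_cases r <;> omega

theorem roots_of_unity_in_Q_sqrt5_sqrt_neg2 (z : ℂ)
    (hz : z ∈ IntermediateField.adjoin ℚ
      ({(Real.sqrt 5 : ℂ), Complex.I * (Real.sqrt 2 : ℂ)} : Set ℂ))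
    (n : ℕ) (hn : 0 < n) (hzn : z ^ n = 1) :
    z = 1 ∨ z = -1 := by
  have hpos : 0 < orderOf z := orderOf_pos_iff.2 (isOfFinOrder_iff_pow_eq_one.2 ⟨n, hn, hzn⟩)
  have hprim := IsPrimitiveRoot.orderOf z
  rcases Nat.lt_or_ge 2 (orderOf z) with hlt | hle
  · exfalso
    have key : ∀ p, p ∣ orderOf z → ∃ w : ℂ, IsPrimitiveRoot w p ∧ ∃ a b c d : ℚ,
        w.re = a + b * Real.sqrt 5 ∧ w.im = Real.sqrt 2 * (c + d * Real.sqrt 5) := by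
      rintro p ⟨q, hq⟩
      exact ⟨z ^ q, hprim.pow hpos (by rw [hq, mul_comm]), aux_coord _ (pow_mem hz q)⟩
    rcases Nat.four_dvd_or_exists_odd_prime_and_dvd_of_two_lt hlt with h4 | ⟨p, hp, hpd, hodd⟩
    · obtain ⟨w, hw, a, b, c, d, h, k⟩ := key 4 h4
      refine aux_no4 w a b c d h k ?_
      have h1 : w ^ 4 = 1 := hw.pow_eq_one
      have h2 : w ^ 2 ≠ 1 := hw.pow_ne_one_of_pos_of_lt (by norm_num) (by norm_num)
      have : (w ^ 2 - 1) * (w ^ 2 + 1) = 0 := by linear_combination h1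
      have := (mul_eq_zero.1 this).resolve_left (sub_ne_zero.2 h2)
      linear_combination this
    · obtain ⟨w, hw, a, b, c, d, h, k⟩ := key p hpd
      have hdeg := aux_deg w a b c d h k
      rw [← Polynomial.cyclotomic_eq_minpoly_rat hw hp.pos, Polynomial.natDegree_cyclotomic,
        Nat.totient_prime hp] at hdeg
      have hp2 := hp.two_le
      have : p ≤ 5 := by omega
      have h1 := hw.pow_eq_one
      have hne : w ≠ 1 := hw.ne_one hp.one_lt
      interval_cases p
      · revert hodd; decide
      · refine aux_no3 w a b c d h k ?_
        have : (w - 1) * (w ^ 2 + w + 1) = 0 := by linear_combination h1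
        exact (mul_eq_zero.1 this).resolve_left (sub_ne_zero.2 hne)
      · revert hodd; decide
      · exact aux_no5 w a b c d h k h1 hne
  · have h2 : z ^ 2 = 1 := by
      apply orderOf_dvd_iff_pow_eq_one.1
      interval_cases orderOf z <;> decide
    exact sq_eq_one_iff.1 h2
end
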